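/- arXiv:2011.02396 — 2 statements merged into one kernel-verified Lean document; each statement's English description precedes it below -/
import Mathlib

section
/- The pairwise least-squares AUC objective equals an average of pointwise losses: F(w) = (1/(n₊n₋)) Σ_{i=1}^n Σ_{j=1}^n (1 − wᵀ(x_i − x_j))² 𝟙[y_i=1] 𝟙[y_j=−1] = (1/n) Σ_{i=1}^n f̃(w; z_i) for every w ∈ ℝ^d, where f̃(w; z) = (1/r)(wᵀ(x − x̄₊))² 𝟙[y=1] + (1/(1−r))(wᵀ(x − x̄₋))² 𝟙[y=−1] + 1 + 2 wᵀ(x̄₋ − x̄₊) + (wᵀ(x̄₋ − x̄₊))². -/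
open scoped BigOperators

/-- Scalar form of the identity, for scores `s` and class weights `a`, `b`. -/
lemma auc_scalar {n : ℕ} (s a b : Fin n → ℝ) (P N mp mn : ℝ)
    (hP : ∑ i, a i = P) (hN : ∑ i, b i = N) (hn : (n : ℝ) = P + N)
    (hP0 : 0 < P) (hN0 : 0 < N)
    (hA : ∑ i, s i * a i = P * mp) (hB : ∑ i, s i * b i = N * mn) :
    (1 / (P * N)) * ∑ i, ∑ j, (1 - (s i - s j)) ^ 2 * a i * b j
    = (1 / (n : ℝ)) * ∑ i, ((1 / (P / n)) * (s i - mp) ^ 2 * a i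
        + (1 / (1 - P / n)) * (s i - mn) ^ 2 * b i
        + 1 + 2 * (mn - mp) + (mn - mp) ^ 2) := by
  have h1 : ∑ i, ∑ j, (1 - (s i - s j)) ^ 2 * a i * b j
      = (P - 2 * (P * mp) + ∑ i, s i ^ 2 * a i) * N + 2 * (P - P * mp) * (N * mn)
        + P * ∑ i, s i ^ 2 * b i := by
    have h : ∀ i, ∑ j, (1 - (s i - s j)) ^ 2 * a i * b j
        = (a i - 2 * (s i * a i) + s i ^ 2 * a i) * N + 2 * (a i - s i * a i) * (N * mn)
          + a i * ∑ j, s j ^ 2 * b j := by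
      intro i
      rw [← hB, ← hN, Finset.mul_sum, Finset.mul_sum, Finset.mul_sum,
        ← Finset.sum_add_distrib, ← Finset.sum_add_distrib]
      exact Finset.sum_congr rfl fun j _ => by ring
    simp only [h]
    rw [Finset.sum_add_distrib, Finset.sum_add_distrib, ← Finset.sum_mul, ← Finset.sum_mul,
      ← Finset.sum_mul, ← Finset.mul_sum, Finset.sum_add_distrib, Finset.sum_sub_distrib,
      Finset.sum_sub_distrib, ← Finset.mul_sum, hA, hP]
  have hv : ∀ (c : Fin n → ℝ) (Q m : ℝ), ∑ i, c i = Q → ∑ i, s i * c i = Q * m →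
      ∀ k : ℝ, ∑ i, k * (s i - m) ^ 2 * c i = k * (∑ i, s i ^ 2 * c i - Q * m ^ 2) := by
    intro c Q m h0 h1 k
    have : ∀ i, k * (s i - m) ^ 2 * c i
        = k * (s i ^ 2 * c i) - (2 * k * m) * (s i * c i) + k * m ^ 2 * c i := by
      intro i; ring
    simp only [this]
    rw [Finset.sum_add_distrib, Finset.sum_sub_distrib, ← Finset.mul_sum, ← Finset.mul_sum,
      ← Finset.mul_sum, h0, h1]
    ring
  rw [h1]
  simp only [Finset.sum_add_distrib]
  rw [hv a P mp hP hA, hv b N mn hN hB]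
  simp only [Finset.sum_const, Finset.card_univ, Fintype.card_fin, nsmul_eq_mul]
  have hPN : P + N ≠ 0 := by positivity
  have h2 : 1 - P / (n : ℝ) = N / (P + N) := by rw [hn]; field_simp; ring
  rw [h2, hn]
  field_simp
  ring

/-- The pairwise least-squares AUC objective equals an average of
pointwise losses. -/
theorem auc_erm_reformulation {n d : ℕ}
    (x : Fin n → Fin d → ℝ) (y : Fin n → ℝ)
    (hy : ∀ i, y i = 1 ∨ y i = -1)
    (np nn : ℕ)
    (hnp : np = (Finset.univ.filter (fun i => y i = 1)).card)
    (hnn : nn = (Finset.univ.filter (fun i => y i = -1)).card)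
    (hnp0 : 0 < np) (hnn0 : 0 < nn)
    (r : ℝ) (hr : r = (np : ℝ) / n)
    (xbp xbn : Fin d → ℝ)
    (hxbp : xbp = fun j => (∑ i, x i j * (if y i = 1 then (1:ℝ) else 0)) / np)
    (hxbn : xbn = fun j => (∑ i, x i j * (if y i = -1 then (1:ℝ) else 0)) / nn)
    (w : Fin d → ℝ) :
    (1 / ((np : ℝ) * nn)) *
        ∑ i, ∑ j, (1 - ∑ l, w l * (x i l - x j l)) ^ 2 *
          (if y i = 1 then (1:ℝ) else 0) * (if y j = -1 then (1:ℝ) else 0)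
    = (1 / (n : ℝ)) * ∑ i,
        ((1 / r) * (∑ l, w l * (x i l - xbp l)) ^ 2 * (if y i = 1 then (1:ℝ) else 0)
        + (1 / (1 - r)) * (∑ l, w l * (x i l - xbn l)) ^ 2 * (if y i = -1 then (1:ℝ) else 0)
        + 1 + 2 * (∑ l, w l * (xbn l - xbp l))
        + (∑ l, w l * (xbn l - xbp l)) ^ 2) := by
  have hP : ∑ i, (if y i = 1 then (1:ℝ) else 0) = np := by
    rw [hnp]; simp
  have hN : ∑ i, (if y i = -1 then (1:ℝ) else 0) = nn := by
    rw [hnn]; simp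
  have hn : (n : ℝ) = np + nn := by
    rw [← hP, ← hN, ← Finset.sum_add_distrib]
    have : ∀ i, (if y i = 1 then (1:ℝ) else 0) + (if y i = -1 then (1:ℝ) else 0) = 1 := by
      intro i
      rcases hy i with h | h <;> rw [h] <;> norm_num
    simp only [this]
    simp
  have hP0 : (0:ℝ) < np := by exact_mod_cast hnp0
  have hN0 : (0:ℝ) < nn := by exact_mod_cast hnn0
  have key : ∀ (c : Fin n → ℝ) (Q : ℝ), 0 < Q →
      ∑ i, (∑ l, w l * x i l) * c i = Q * ∑ l, w l * ((∑ i, x i l * c i) / Q) := by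
    intro c Q hQ
    simp only [Finset.sum_mul, Finset.mul_sum, Finset.sum_div]
    rw [Finset.sum_comm]
    refine Finset.sum_congr rfl fun l _ => Finset.sum_congr rfl fun i _ => ?_
    field_simp
  have hA := key (fun i => if y i = 1 then (1:ℝ) else 0) np hP0
  have hB := key (fun i => if y i = -1 then (1:ℝ) else 0) nn hN0
  have main := auc_scalar (fun i => ∑ l, w l * x i l) _ _ _ _ _ _ hP hN hn hP0 hN0 hA hB
  simp only [mul_sub, Finset.sum_sub_distrib]
  rw [hr, hxbp, hxbn]
  simpa only [mul_sub] using main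
end

section
/- Tail bound for the largest k squared Gaussian variables: let g_1, …, g_d be real random variables on a common probability space, each zero-mean Gaussian with variance at most σ² (with arbitrary joint dependence), and let g_{(1)} ≥ g_{(2)} ≥ … ≥ g_{(d)} be a non-increasing rearrangement of |g_1|, …, |g_d|. Then for all t > 0 and all k ∈ {1,…,d}, P( (1/(kσ²)) Σ_{j=1}^k g_{(j)}² > t log(2d/k) ) ≤ (2d/k)^{1 − 3t/8}. -/
open scoped BigOperators
open MeasureTheory ProbabilityTheory

lemma gauss_exp_sq_lintegral_le (σ : ℝ) (hσ : 0 < σ) (v : NNReal) (hv : (v : ℝ) ≤ σ ^ 2) :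
    ∫⁻ x, ENNReal.ofReal (Real.exp (3 * x ^ 2 / (8 * σ ^ 2))) ∂(gaussianReal 0 v) ≤ 2 := by
  have hσ2 : 0 < σ ^ 2 := by positivity
  by_cases h0 : v = 0
  · subst h0
    rw [gaussianReal_zero_var, lintegral_dirac]
    simp
  have hvpos : 0 < (v : ℝ) := by
    have := pos_iff_ne_zero.mpr h0
    exact_mod_cast this
  rw [gaussianReal_of_var_ne_zero _ h0,
    lintegral_withDensity_eq_lintegral_mul _ (measurable_gaussianPDF 0 v) (by fun_prop)]
  have hb : 0 < 1 / (8 * (v : ℝ)) := by positivity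
  have hint : Integrable (fun x : ℝ => (√(2 * Real.pi * v))⁻¹ *
      Real.exp (-(1 / (8 * (v : ℝ))) * x ^ 2)) :=
    (integrable_exp_neg_mul_sq hb).const_mul _
  have hval : ∫ x : ℝ, (√(2 * Real.pi * v))⁻¹ * Real.exp (-(1 / (8 * (v : ℝ))) * x ^ 2) = 2 := by
    rw [integral_const_mul, integral_gaussian]
    have h1 : Real.pi / (1 / (8 * (v : ℝ))) = 2 ^ 2 * (2 * Real.pi * v) := by
      field_simp; norm_num
    have h2 : 0 < √(2 * Real.pi * v) := Real.sqrt_pos.mpr (by positivity)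
    rw [h1, Real.sqrt_mul (x := (2 : ℝ) ^ 2) (by norm_num), Real.sqrt_sq (by norm_num : (0 : ℝ) ≤ 2)]
    field_simp
  calc _ ≤ ∫⁻ x : ℝ, ENNReal.ofReal ((√(2 * Real.pi * v))⁻¹ *
      Real.exp (-(1 / (8 * (v : ℝ))) * x ^ 2)) := by
        apply lintegral_mono
        intro x
        simp only [Pi.mul_apply, gaussianPDF]
        rw [← ENNReal.ofReal_mul (gaussianPDFReal_nonneg _ _ _)]
        apply ENNReal.ofReal_le_ofReal
        rw [gaussianPDFReal, mul_assoc, ← Real.exp_add]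
        gcongr
        have h3 : 3 * x ^ 2 / (8 * σ ^ 2) ≤ 3 * x ^ 2 / (8 * v) := by gcongr
        have h4 : -(x - 0) ^ 2 / (2 * (v : ℝ)) + 3 * x ^ 2 / (8 * v)
            = -(1 / (8 * (v : ℝ))) * x ^ 2 := by
          field_simp; ring
        linarith
    _ = 2 := by
        rw [← ofReal_integral_eq_lintegral_ofReal hint
          (Filter.Eventually.of_forall fun x => by positivity), hval]
        simp

/-- Tail bound for the sum of the `k` largest squared Gaussian variables
(Bellec).  Each `g i` is a centered Gaussian with variance at most `σ²` (arbitrary joint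
dependence).  The sum of the `k` largest among `g_{(1)}² ≥ ⋯ ≥ g_{(d)}²` exceeds a threshold
iff some set `S` of `k` coordinates has `∑_{j ∈ S} g_j²` exceeding it. -/
theorem ordered_gaussian_tail_bound {Ω : Type*} [MeasurableSpace Ω]
    (P : Measure Ω) [IsProbabilityMeasure P]
    {d : ℕ} (g : Fin d → Ω → ℝ) (hmeas : ∀ i, Measurable (g i))
    (σ : ℝ) (hσ : 0 < σ)
    (hgauss : ∀ i, ∃ v : NNReal, (v : ℝ) ≤ σ ^ 2 ∧
      Measure.map (g i) P = gaussianReal 0 v)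
    (t : ℝ) (ht : 0 < t) (k : ℕ) (hk1 : 1 ≤ k) (hkd : k ≤ d) :
    (P {ω | ∃ S : Finset (Fin d), S.card = k ∧
        1 / (k * σ ^ 2) * ∑ j ∈ S, (g j ω) ^ 2 > t * Real.log (2 * d / k)}).toReal
      ≤ (2 * d / k) ^ ((1 : ℝ) - 3 * t / 8) := by
  have hk : (0 : ℝ) < k := by exact_mod_cast hk1
  have hd : (0 : ℝ) < d := by exact_mod_cast (lt_of_lt_of_le hk1 hkd)
  have hσ2 : 0 < σ ^ 2 := by positivity
  set R : ℝ := 2 * d / k with hR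
  have hRpos : 0 < R := by positivity
  set F : Fin d → Ω → ENNReal := fun j ω =>
    ENNReal.ofReal (Real.exp (3 * (g j ω) ^ 2 / (8 * σ ^ 2))) with hF
  have hFm : ∀ j, Measurable (F j) := fun j => by
    have := hmeas j
    fun_prop
  have hFi : ∀ j, ∫⁻ ω, F j ω ∂P ≤ 2 := by
    intro j
    obtain ⟨v, hv, hmap⟩ := hgauss j
    have h := gauss_exp_sq_lintegral_le σ hσ v hv
    rw [← hmap, lintegral_map (by fun_prop) (hmeas j)] at h
    exact h
  have hsum : ∫⁻ ω, ∑ j, F j ω ∂P ≤ ENNReal.ofReal (2 * d) := by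
    rw [lintegral_finsetSum _ (fun j _ => hFm j)]
    refine (Finset.sum_le_sum fun j _ => hFi j).trans (le_of_eq ?_)
    rw [Finset.sum_const, Finset.card_univ, Fintype.card_fin, nsmul_eq_mul,
      ENNReal.ofReal_mul (by norm_num), mul_comm]
    simp
  set c : ℝ := k * R ^ (3 * t / 8) with hc
  have hcpos : 0 < c := by positivity
  have hsub : {ω | ∃ S : Finset (Fin d), S.card = k ∧
        1 / (k * σ ^ 2) * ∑ j ∈ S, (g j ω) ^ 2 > t * Real.log R} ⊆
      {ω | ENNReal.ofReal c ≤ ∑ j, F j ω} := by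
    rintro ω ⟨S, hS, hgt⟩
    have hS1 : ∑ j ∈ S, (1 / (k : ℝ)) = 1 := by
      rw [Finset.sum_const, hS, nsmul_eq_mul]; field_simp
    have hJ := convexOn_exp.map_sum_le (t := S) (w := fun _ => 1 / (k : ℝ))
      (p := fun j => 3 * (g j ω) ^ 2 / (8 * σ ^ 2))
      (fun _ _ => by positivity) hS1 (fun _ _ => Set.mem_univ _)
    simp only [smul_eq_mul, ← Finset.mul_sum] at hJ
    have he : 1 / (k : ℝ) * ∑ j ∈ S, 3 * (g j ω) ^ 2 / (8 * σ ^ 2)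
        = 3 / 8 * (1 / (k * σ ^ 2) * ∑ j ∈ S, (g j ω) ^ 2) := by
      rw [← Finset.sum_div, ← Finset.mul_sum]; field_simp
    have h1 : R ^ (3 * t / 8) ≤ 1 / (k : ℝ) * ∑ j ∈ S, Real.exp (3 * (g j ω) ^ 2 / (8 * σ ^ 2)) := by
      refine le_trans ?_ hJ
      rw [Real.rpow_def_of_pos hRpos, he]
      apply Real.exp_le_exp.mpr
      linarith
    have h2 : c ≤ ∑ j ∈ S, Real.exp (3 * (g j ω) ^ 2 / (8 * σ ^ 2)) := by
      have h3 := mul_le_mul_of_nonneg_left h1 hk.le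
      rw [← mul_assoc, mul_one_div_cancel hk.ne', one_mul] at h3
      exact h3
    have h4 : c ≤ ∑ j, Real.exp (3 * (g j ω) ^ 2 / (8 * σ ^ 2)) :=
      h2.trans (Finset.sum_le_sum_of_subset_of_nonneg (Finset.subset_univ S)
        fun _ _ _ => (Real.exp_pos _).le)
    simp only [Set.mem_setOf_eq, hF]
    rw [← ENNReal.ofReal_sum_of_nonneg fun _ _ => (Real.exp_pos _).le]
    exact ENNReal.ofReal_le_ofReal h4
  have hmk := mul_meas_ge_le_lintegral (μ := P) (f := fun ω => ∑ j, F j ω)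
    (Finset.measurable_fun_sum _ fun j _ => hFm j) (ENNReal.ofReal c)
  have hfin := (mul_le_mul_right (measure_mono (μ := P) hsub) (ENNReal.ofReal c)).trans
    (hmk.trans hsum)
  have hreal := ENNReal.toReal_mono ENNReal.ofReal_ne_top hfin
  rw [ENNReal.toReal_mul, ENNReal.toReal_ofReal hcpos.le,
    ENNReal.toReal_ofReal (by positivity)] at hreal
  have hfinal : R ^ ((1 : ℝ) - 3 * t / 8) = 2 * d / c := by
    rw [Real.rpow_sub hRpos, Real.rpow_one, hc, hR, div_div]
  rw [hfinal, le_div_iff₀ hcpos, mul_comm]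
  exact hreal
end
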